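/- Let (aₙ) ∈ {1,2,3,4}^ℕ admit a generalized right eigenvector u. For 0 ≤ k ≤ ℓ put P_{[k,ℓ)} = M_{a_k}···M_{a_{ℓ−1}}, and set u_k = P_{[0,k)}⁻¹·u and 𝟏_k = ᵗP_{[0,k)}·𝟏. Let m < n with n ≥ 3 and P_{[n−3,n+3)} = (M₁M₂M₃)², let v ∈ ℝ³ have nonnegative entries with v ≠ 0, let C > 0, and let K ≥ 0 be such that ‖P_{[m,n)}·x‖_∞ ≤ K·‖x‖_∞ holds for every x ∈ ℝ³ with ⟨x, 𝟏_n⟩ = 0. If ‖π_{u_n,𝟏}(v)‖_∞ ≤ C, then ‖π_{u_m,𝟏}(P_{[m,n)}·v)‖_∞ ≤ (22/7)·C·K. -/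

import Mathlib

open Matrix

noncomputable section

def M1 : Matrix (Fin 3) (Fin 3) ℝ := !![1,1,1; 0,1,0; 0,0,1]
def M2 : Matrix (Fin 3) (Fin 3) ℝ := !![1,0,0; 1,1,1; 0,0,1]
def M3 : Matrix (Fin 3) (Fin 3) ℝ := !![1,0,0; 0,1,0; 1,1,1]
def M4 : Matrix (Fin 3) (Fin 3) ℝ := !![0,1,1; 1,0,1; 1,1,0]

def Mat : Fin 4 → Matrix (Fin 3) (Fin 3) ℝ := ![M1, M2, M3, M4]

/-- `Pprod a k l = M_{a_k} ⋯ M_{a_{l-1}}` (the identity if `l ≤ k`). -/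
def Pprod (a : ℕ → Fin 4) (k l : ℕ) : Matrix (Fin 3) (Fin 3) ℝ :=
  (List.ofFn fun j : Fin (l - k) => Mat (a (k + j))).prod

/-- `u` is a generalized right eigenvector of the sequence of matrices `(M_{aₙ})`:
u is nonzero, nonnegative, and `⋂ₙ M_{a₀}⋯M_{a_{n-1}}·ℝ³₊ = ℝ₊·u`. -/
def genRightEV (a : ℕ → Fin 4) (u : Fin 3 → ℝ) : Prop :=
  u ≠ 0 ∧ (∀ i, 0 ≤ u i) ∧
    (⋂ n : ℕ, (Pprod a 0 n).mulVec '' {v : Fin 3 → ℝ | ∀ i, 0 ≤ v i})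
      = {w : Fin 3 → ℝ | ∃ c : ℝ, 0 ≤ c ∧ w = c • u}

/-- The projection `π_{u,w}(x) = x − (⟨x,w⟩/⟨u,w⟩)·u` onto `w^⊥` along `u`. -/
def projv (u w x : Fin 3 → ℝ) : Fin 3 → ℝ :=
  x - ((∑ i, x i * w i) / (∑ i, u i * w i)) • u

lemma forall_fin_three {P : Fin 3 → Prop} : (∀ i, P i) ↔ P 0 ∧ P 1 ∧ P 2 := by
  simp [Fin.forall_fin_succ]

lemma Pprod_eq_map_range' (a : ℕ → Fin 4) (k l : ℕ) :
    Pprod a k l = ((List.range' k (l - k)).map fun j => Mat (a j)).prod := by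
  unfold Pprod
  congr 1
  apply List.ext_getElem <;> simp

lemma Pprod_mul (a : ℕ → Fin 4) {k l r : ℕ} (hkl : k ≤ l) (hlr : l ≤ r) :
    Pprod a k l * Pprod a l r = Pprod a k r := by
  simp only [Pprod_eq_map_range']
  obtain ⟨s, rfl⟩ := Nat.exists_eq_add_of_le hkl
  obtain ⟨t, rfl⟩ := Nat.exists_eq_add_of_le hlr
  have h : k + s + t - k = s + t := by omega
  rw [Nat.add_sub_cancel_left, Nat.add_sub_cancel_left, h, ← List.range'_append_1,
    List.map_append, List.prod_append]

lemma Pprod_succ (a : ℕ → Fin 4) (k : ℕ) : Pprod a k (k + 1) = Mat (a k) := by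
  simp [Pprod]

lemma Mat_nonneg (i : Fin 4) (j k : Fin 3) : 0 ≤ Mat i j k := by
  fin_cases i <;> fin_cases j <;> fin_cases k <;> simp [Mat, M1, M2, M3, M4]

lemma Mat_det_ne_zero (i : Fin 4) : (Mat i).det ≠ 0 := by
  fin_cases i <;> simp [Mat, M1, M2, M3, M4, Matrix.det_fin_three]

lemma Pprod_nonneg (a : ℕ → Fin 4) (k l : ℕ) (i j : Fin 3) : 0 ≤ Pprod a k l i j := by
  rw [Pprod_eq_map_range']
  induction List.range' k (l - k) generalizing i j with
  | nil => simp only [List.map_nil, List.prod_nil, Matrix.one_apply]; split_ifs <;> norm_num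
  | cons x t ih =>
    simp only [List.map_cons, List.prod_cons, Matrix.mul_apply]
    exact Finset.sum_nonneg fun c _ => mul_nonneg (Mat_nonneg _ _ _) (ih _ _)

lemma Pprod_isUnit_det (a : ℕ → Fin 4) (k l : ℕ) : IsUnit (Pprod a k l).det := by
  rw [Pprod_eq_map_range']
  induction List.range' k (l - k) with
  | nil => simp
  | cons x t ih =>
    simp only [List.map_cons, List.prod_cons, Matrix.det_mul]
    exact (Mat_det_ne_zero _).isUnit.mul ih

lemma mulVec_nonneg_of_nonneg {A : Matrix (Fin 3) (Fin 3) ℝ} (hA : ∀ i j, 0 ≤ A i j)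
    {x : Fin 3 → ℝ} (hx : ∀ i, 0 ≤ x i) (i : Fin 3) : 0 ≤ A.mulVec x i :=
  Finset.sum_nonneg (s := Finset.univ) fun j _ => mul_nonneg (hA i j) (hx j)

lemma Mat_mul_entries (i : Fin 4) (B : Matrix (Fin 3) (Fin 3) ℝ) (j : Fin 3) :
    (Mat i * B) 0 j = ![B 0 j + B 1 j + B 2 j, B 0 j, B 0 j, B 1 j + B 2 j] i ∧
    (Mat i * B) 1 j = ![B 1 j, B 0 j + B 1 j + B 2 j, B 1 j, B 0 j + B 2 j] i ∧
    (Mat i * B) 2 j = ![B 2 j, B 2 j, B 0 j + B 1 j + B 2 j, B 0 j + B 1 j] i := by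
  fin_cases i <;> simp [Mat, M1, M2, M3, M4, Matrix.mul_apply, Fin.sum_univ_three]

/-- A row of `M_i B` that exceeds the sum of the two others in some column determines `i`. -/
lemma eq_of_row_dominates {i : Fin 4} {B : Matrix (Fin 3) (Fin 3) ℝ}
    (hB : ∀ j k, 0 ≤ B j k) (j : Fin 3) :
    ((Mat i * B) 1 j + (Mat i * B) 2 j < (Mat i * B) 0 j → i = 0) ∧
    ((Mat i * B) 0 j + (Mat i * B) 2 j < (Mat i * B) 1 j → i = 1) ∧
    ((Mat i * B) 0 j + (Mat i * B) 1 j < (Mat i * B) 2 j → i = 2) := by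
  obtain ⟨h0, h1, h2⟩ := Mat_mul_entries i B j
  rw [h0, h1, h2]
  have := hB 0 j
  have := hB 1 j
  have := hB 2 j
  refine ⟨fun h => ?_, fun h => ?_, fun h => ?_⟩ <;> fin_cases i <;> simp at h ⊢ <;> linarith

lemma Mat_mul_left_cancel (i : Fin 4) {B B' : Matrix (Fin 3) (Fin 3) ℝ}
    (h : Mat i * B = Mat i * B') : B = B' :=
  ((Matrix.isUnit_iff_isUnit_det _).2 (Mat_det_ne_zero i).isUnit).mul_left_cancel h

lemma M1_mul_M2_mul_M3 : M1 * M2 * M3 = !![4, 3, 2; 2, 2, 1; 1, 1, 1] := by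
  ext i j
  fin_cases i <;> fin_cases j <;>
    simp [M1, M2, M3, Matrix.mul_apply, Fin.sum_univ_three] <;> norm_num

/-- The only factorization of `(M₁M₂M₃)²` starting with three of the `M_i` and a nonnegative
matrix is the obvious one. -/
lemma factorization_unique {i j k : Fin 4} {B : Matrix (Fin 3) (Fin 3) ℝ}
    (hB : ∀ r s, 0 ≤ B r s) (h : Mat i * (Mat j * (Mat k * B)) = (M1 * M2 * M3) ^ 2) :
    i = 0 ∧ j = 1 ∧ k = 2 ∧ B = M1 * M2 * M3 := by
  have mul_nonneg' (i : Fin 4) {B : Matrix (Fin 3) (Fin 3) ℝ} (hB : ∀ r s, 0 ≤ B r s) :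
      ∀ r s, 0 ≤ (Mat i * B) r s := fun r s => by
    rw [Matrix.mul_apply]
    exact Finset.sum_nonneg fun c _ => mul_nonneg (Mat_nonneg _ _ _) (hB _ _)
  have hsq : (M1 * M2 * M3) ^ 2 = Mat 0 * (Mat 1 * (Mat 2 * (M1 * M2 * M3))) := by
    simp only [Mat, pow_two, Matrix.mul_assoc]
    rfl
  rw [hsq] at h
  have hi : i = 0 := by
    apply (eq_of_row_dominates (mul_nonneg' j (mul_nonneg' k hB)) 0).1
    rw [h]
    simp only [M1_mul_M2_mul_M3, Mat_mul_entries]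
    simp
  subst hi
  replace h := Mat_mul_left_cancel _ h
  have hj : j = 1 := by
    apply (eq_of_row_dominates (mul_nonneg' k hB) 0).2.1
    rw [h]
    simp only [M1_mul_M2_mul_M3, Mat_mul_entries]
    simp
  subst hj
  replace h := Mat_mul_left_cancel _ h
  have hk : k = 2 := by
    apply (eq_of_row_dominates hB 0).2.2
    rw [h]
    simp only [M1_mul_M2_mul_M3, Mat_mul_entries]
    simp
  subst hk
  exact ⟨rfl, rfl, rfl, Mat_mul_left_cancel _ h⟩

lemma Pprod_block {a : ℕ → Fin 4} {n : ℕ}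
    (h : Pprod a n (n + 6) = (M1 * M2 * M3) ^ 2) :
    Pprod a n (n + 3) = M1 * M2 * M3 ∧ Pprod a (n + 3) (n + 6) = M1 * M2 * M3 := by
  have h3 : Pprod a n (n + 3) = Mat (a n) * Mat (a (n + 1)) * Mat (a (n + 2)) := by
    rw [← Pprod_mul a (l := n + 2) (by omega) (by omega),
      ← Pprod_mul a (l := n + 1) (by omega) (by omega), Pprod_succ, Pprod_succ, Pprod_succ]
  rw [← Pprod_mul a (l := n + 3) (by omega) (by omega), h3, Matrix.mul_assoc,
    Matrix.mul_assoc] at h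
  obtain ⟨hi, hj, hk, hB⟩ := factorization_unique (Pprod_nonneg a _ _) h
  refine ⟨?_, hB⟩
  rw [h3, hi, hj, hk]
  rfl

lemma genRightEV_exists_nonneg {a : ℕ → Fin 4} {u : Fin 3 → ℝ} (hu : genRightEV a u) (n : ℕ) :
    ∃ x : Fin 3 → ℝ, (∀ i, 0 ≤ x i) ∧ (Pprod a 0 n).mulVec x = u := by
  have h : u ∈ {w : Fin 3 → ℝ | ∃ c : ℝ, 0 ≤ c ∧ w = c • u} := ⟨1, by norm_num, by simp⟩
  rw [← hu.2.2] at h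
  exact Set.mem_iInter.1 h n

lemma projv_add_smul {u w : Fin 3 → ℝ} (h : ∑ i, u i * w i ≠ 0) (x : Fin 3 → ℝ) (t : ℝ) :
    projv u w (x + t • u) = projv u w x := by
  have hs : ∑ i, (x + t • u) i * w i = ∑ i, x i * w i + t * ∑ i, u i * w i := by
    simp only [Pi.add_apply, Pi.smul_apply, smul_eq_mul, add_mul, Finset.sum_add_distrib,
      Finset.mul_sum, mul_assoc]
  rw [projv, hs, add_div, mul_div_assoc, div_self h, mul_one, add_smul, projv]
  abel

lemma sum_projv_mul {u w : Fin 3 → ℝ} (h : ∑ i, u i * w i ≠ 0) (x : Fin 3 → ℝ) :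
    ∑ i, projv u w x i * w i = 0 := by
  simp only [projv, Pi.sub_apply, Pi.smul_apply, smul_eq_mul, sub_mul, Finset.sum_sub_distrib,
    mul_assoc, ← Finset.mul_sum]
  field_simp
  ring

lemma abs_sub_div_mul_le {x S D t c : ℝ} (hD : 0 < D) (h₁ : x * D - S * t ≤ c * D)
    (h₂ : S * t - x * D ≤ c * D) : |x - S / D * t| ≤ c := by
  have h : x - S / D * t = (x * D - S * t) / D := by field_simp
  rw [h, abs_div, abs_of_pos hD, div_le_iff₀ hD, abs_le]
  constructor <;> linarith

lemma norm_projv_one_le {u : Fin 3 → ℝ} (hu : ∀ i, 0 ≤ u i) (hs : 0 < ∑ i, u i * 1)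
    (x : Fin 3 → ℝ) : ‖projv u (fun _ => 1) x‖ ≤ 2 * ‖x‖ := by
  rw [pi_norm_le_iff_of_nonneg (by positivity)]
  intro i
  have h₀ (k j) : 0 ≤ u k * (‖x‖ + x j) :=
    mul_nonneg (hu k) (by linarith [(abs_le.1 (norm_le_pi_norm x j)).1])
  have h₁ (k j) : 0 ≤ u k * (‖x‖ - x j) :=
    mul_nonneg (hu k) (by linarith [(abs_le.1 (norm_le_pi_norm x j)).2])
  simp only [forall_fin_three] at h₀ h₁
  apply abs_sub_div_mul_le hs <;> simp only [Fin.sum_univ_three] <;> revert i <;>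
    rw [forall_fin_three] <;> refine ⟨?_, ?_, ?_⟩ <;> linarith

/-- `π_{u,w}` expands vectors of the plane `𝟏^⊥` by at most `11/7` when `u` and `w` lie in the
cones spanned by the columns, resp. the rows, of `M₁M₂M₃`. -/
lemma norm_projv_block_le {p q : Fin 3 → ℝ} (hp : ∀ i, 0 ≤ p i) (hq : ∀ i, 0 ≤ q i)
    (hs : 0 < ∑ i, (M1 * M2 * M3).mulVec p i * (M1 * M2 * M3)ᵀ.mulVec q i)
    {z : Fin 3 → ℝ} (hz : ∑ i, z i * 1 = 0) :
    ‖projv ((M1 * M2 * M3).mulVec p) ((M1 * M2 * M3)ᵀ.mulVec q) z‖ ≤ 11 / 7 * ‖z‖ := by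
  rw [pi_norm_le_iff_of_nonneg (by positivity)]
  intro i
  have h₀ (k l j) : 0 ≤ p k * q l * (‖z‖ + z j) :=
    mul_nonneg (mul_nonneg (hp k) (hq l)) (by linarith [(abs_le.1 (norm_le_pi_norm z j)).1])
  have h₁ (k l j) : 0 ≤ p k * q l * (‖z‖ - z j) :=
    mul_nonneg (mul_nonneg (hp k) (hq l)) (by linarith [(abs_le.1 (norm_le_pi_norm z j)).2])
  have hz₂ : z 2 = -z 0 - z 1 := by
    simp only [Fin.sum_univ_three] at hz
    linarith
  have hu : (M1 * M2 * M3).mulVec p =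
      ![4 * p 0 + 3 * p 1 + 2 * p 2, 2 * p 0 + 2 * p 1 + p 2, p 0 + p 1 + p 2] := by
    rw [M1_mul_M2_mul_M3]
    ext i
    fin_cases i <;> simp [Matrix.mulVec, dotProduct, Fin.sum_univ_three]
  have hw : (M1 * M2 * M3)ᵀ.mulVec q =
      ![4 * q 0 + 2 * q 1 + q 2, 3 * q 0 + 2 * q 1 + q 2, 2 * q 0 + q 1 + q 2] := by
    rw [M1_mul_M2_mul_M3]
    ext i
    fin_cases i <;> simp [Matrix.mulVec, dotProduct, Fin.sum_univ_three]
  simp only [forall_fin_three, hz₂] at h₀ h₁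
  apply abs_sub_div_mul_le hs <;> clear hs <;>
    simp only [Fin.sum_univ_three, hu, hw, cons_val] <;> revert i <;>
    rw [forall_fin_three] <;> simp only [cons_val, hz₂] <;> refine ⟨?_, ?_, ?_⟩ <;> linarith

/-- If (aₙ) admits a generalized right eigenvector u, `u_k = P_{[0,k)}⁻¹u`,
`𝟏_k = ᵗP_{[0,k)}·𝟏`, m < n with `P_{[n-3,n+3)} = (M₁M₂M₃)²`, v is nonzero and
nonnegative, C > 0, K ≥ 0 bounds `P_{[m,n)}` on the hyperplane `𝟏_n^⊥` (max norm),
and `‖π_{u_n,𝟏}(v)‖_∞ ≤ C`, then `‖π_{u_m,𝟏}(P_{[m,n)}v)‖_∞ ≤ (22/7)·C·K`. -/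
theorem projection_transport_bound (a : ℕ → Fin 4) (u : Fin 3 → ℝ)
    (hu : genRightEV a u) (m n : ℕ) (hmn : m < n) (hn3 : 3 ≤ n)
    (hblock : Pprod a (n - 3) (n + 3) = (M1 * M2 * M3) ^ 2)
    (v : Fin 3 → ℝ) (hv : ∀ i, 0 ≤ v i) (hv0 : v ≠ 0)
    (C : ℝ) (hC : 0 < C) (K : ℝ) (hK : 0 ≤ K)
    (hKbound : ∀ x : Fin 3 → ℝ,
      (∑ i, x i * ((Pprod a 0 n)ᵀ.mulVec (fun _ => 1)) i) = 0 →
      ‖(Pprod a m n).mulVec x‖ ≤ K * ‖x‖)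
    (hproj : ‖projv ((Pprod a 0 n)⁻¹.mulVec u) (fun _ => 1) v‖ ≤ C) :
    ‖projv ((Pprod a 0 m)⁻¹.mulVec u) (fun _ => 1) ((Pprod a m n).mulVec v)‖
      ≤ 22 / 7 * C * K := by
  obtain ⟨x, hx, hxu⟩ := genRightEV_exists_nonneg hu (n + 3)
  obtain ⟨k, rfl⟩ := Nat.exists_eq_add_of_le' hn3
  obtain ⟨hb₁, hb₂⟩ := Pprod_block (a := a) (n := k) (by simpa using hblock)
  have hinv (l : ℕ) (hl : l ≤ k + 3 + 3) :
      (Pprod a 0 l)⁻¹.mulVec u = (Pprod a l (k + 3 + 3)).mulVec x := by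
    rw [← hxu, ← Pprod_mul a (Nat.zero_le l) hl, ← Matrix.mulVec_mulVec, Matrix.mulVec_mulVec,
      Matrix.nonsing_inv_mul _ (Pprod_isUnit_det a 0 l), Matrix.one_mulVec]
  have hun := hinv (k + 3) (by omega)
  have hum := hinv m (by omega)
  rw [show Pprod a (k + 3) (k + 3 + 3) = M1 * M2 * M3 from hb₂] at hun
  set un := (Pprod a 0 (k + 3))⁻¹.mulVec u with hun_def
  set um := (Pprod a 0 m)⁻¹.mulVec u with hum_def
  set w := (Pprod a 0 (k + 3))ᵀ.mulVec (fun _ => 1) with hw_def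
  have hw : w = (M1 * M2 * M3)ᵀ.mulVec ((Pprod a 0 k)ᵀ.mulVec (fun _ => 1)) := by
    rw [hw_def, ← Pprod_mul a (Nat.zero_le k) (by omega : k ≤ k + 3), hb₁,
      Matrix.transpose_mul, Matrix.mulVec_mulVec]
  have hum0 (i) : 0 ≤ um i := by
    rw [hum]
    exact mulVec_nonneg_of_nonneg (Pprod_nonneg _ _ _) hx i
  have hun0 (i) : 0 ≤ un i := by
    rw [hun_def, hinv _ (by omega)]
    exact mulVec_nonneg_of_nonneg (Pprod_nonneg _ _ _) hx i
  have hPu (l : ℕ) : (Pprod a 0 l).mulVec ((Pprod a 0 l)⁻¹.mulVec u) = u := by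
    rw [Matrix.mulVec_mulVec, Matrix.mul_nonsing_inv _ (Pprod_isUnit_det a 0 l),
      Matrix.one_mulVec]
  have hsum_pos {y : Fin 3 → ℝ} (hy : ∀ i, 0 ≤ y i) (hy0 : y ≠ 0) : 0 < ∑ i, y i * 1 := by
    simp only [mul_one]
    exact Fintype.sum_pos (lt_of_le_of_ne hy hy0.symm)
  have hne (l : ℕ) : (Pprod a 0 l)⁻¹.mulVec u ≠ 0 := fun h => hu.1 (by
    rw [← hPu l, h, Matrix.mulVec_zero])
  have hunw : 0 < ∑ i, un i * w i := by
    have h : un ⬝ᵥ w = u ⬝ᵥ (fun _ => 1) := by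
      rw [hw_def, Matrix.mulVec_transpose, dotProduct_comm, ← Matrix.dotProduct_mulVec,
        hun_def, hPu, dotProduct_comm]
    exact lt_of_lt_of_eq (hsum_pos hu.2.1 hu.1) h.symm
  have hun1 := hsum_pos hun0 (hne _)
  have hum1 := hsum_pos hum0 (hne _)
  have hPun : (Pprod a m (k + 3)).mulVec un = um := by
    rw [hum, hun, ← hb₂, Matrix.mulVec_mulVec, Pprod_mul a hmn.le (by omega)]
  set z := projv un (fun _ => 1) v with hz_def
  set y := projv un w z with hy_def
  obtain ⟨t, ht⟩ : ∃ t : ℝ, v = y + t • un := by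
    refine ⟨(∑ i, z i * w i) / (∑ i, un i * w i) + (∑ i, v i * 1) / (∑ i, un i * 1), ?_⟩
    rw [hy_def, projv, add_smul, ← add_assoc, sub_add_cancel, hz_def, projv, sub_add_cancel]
  have hy : ‖y‖ ≤ 11 / 7 * ‖z‖ := by
    have hz := sum_projv_mul hun1.ne' v
    rw [← hz_def] at hz
    rw [hun, hw] at hunw
    rw [hy_def, hun, hw]
    exact norm_projv_block_le hx (fun i => mulVec_nonneg_of_nonneg
      (fun i j => Pprod_nonneg a 0 k j i) (fun _ => zero_le_one) i) hunw hz
  rw [ht, Matrix.mulVec_add, Matrix.mulVec_smul, hPun, projv_add_smul hum1.ne']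
  calc ‖projv um (fun _ => 1) ((Pprod a m (k + 3)).mulVec y)‖
      ≤ 2 * ‖(Pprod a m (k + 3)).mulVec y‖ := norm_projv_one_le hum0 hum1 _
    _ ≤ 2 * (K * ‖y‖) := by
        gcongr
        exact hKbound y (sum_projv_mul hunw.ne' z)
    _ ≤ 2 * (K * (11 / 7 * C)) := by
        gcongr
        linarith
    _ = 22 / 7 * C * K := by ring

end
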